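/- arXiv:cs/0607020 — 4 statements merged into one kernel-verified Lean document; each statement's English description precedes it below -/
import Mathlib

section
/- Let M be a real random variable whose law has a symmetric LLR density g. Then E[tanh(|M|/2)] = 1 - 2·Pe(M), where Pe(M) = ∫_{-∞}^0 g(m) dm. -/
open MeasureTheory

/-- `tanh (x / 2)` as a logistic ratio, with the denominator cleared. -/
lemma one_add_exp_neg_mul_tanh_half (x : ℝ) :
    (1 + Real.exp (-x)) * Real.tanh (x / 2) = 1 - Real.exp (-x) := by
  have h : Real.exp (-x) = Real.exp (-(x / 2)) * Real.exp (-(x / 2)) := by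
    rw [← Real.exp_add]
    ring_nf
  have h' : Real.exp (x / 2) * Real.exp (-(x / 2)) = 1 := by
    rw [← Real.exp_add]
    simp
  have hpos : 0 < Real.exp (x / 2) + Real.exp (-(x / 2)) := by positivity
  rw [Real.tanh_eq, ← mul_div_assoc, div_eq_iff hpos.ne', h]
  linear_combination (2 * Real.exp (-(x / 2))) * h'

/-- Folding an integral over the real line onto the positive half-line. -/
lemma integral_eq_integral_Ioi_add_comp_neg {f : ℝ → ℝ} (hf : Integrable f) :
    ∫ x, f x = ∫ x in Set.Ioi (0 : ℝ), (f x + f (-x)) := by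
  rw [integral_add hf.integrableOn hf.comp_neg.integrableOn, integral_comp_neg_Ioi, neg_zero,
    ← intervalIntegral.integral_Iic_add_Ioi hf.integrableOn hf.integrableOn (b := 0), add_comm]

/-- If `M` is a real random variable whose law has a symmetric
LLR density `g` (i.e. `g` is measurable, nonnegative, integrates to `1` and
satisfies `g (-m) = exp (-m) * g m`), then
`E[tanh (|M| / 2)] = 1 - 2 * Pe(M)` where `Pe(M) = ∫_{-∞}^0 g`. -/
theorem expectation_tanh_abs_half_eq_one_sub_two_mul_Pe
    {Ω : Type*} [MeasurableSpace Ω] (ℙ : Measure Ω) [IsProbabilityMeasure ℙ]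
    (M : Ω → ℝ) (hM : Measurable M) (g : ℝ → ℝ)
    (hg_meas : Measurable g) (hg_nonneg : ∀ m, 0 ≤ g m)
    (hg_one : ∫ m, g m = 1)
    (hg_sym : ∀ m : ℝ, g (-m) = Real.exp (-m) * g m)
    (hlaw : Measure.map M ℙ = volume.withDensity (fun m => ENNReal.ofReal (g m))) :
    ∫ ω, Real.tanh (|M ω| / 2) ∂ℙ = 1 - 2 * ∫ m in Set.Iio (0 : ℝ), g m := by
  have hg : Integrable g := by
    by_contra h
    simp [integral_undef h] at hg_one
  have hcont : Continuous fun m : ℝ => Real.tanh (|m| / 2) := by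
    simp only [Real.tanh_eq_sinh_div_cosh]
    exact (Real.continuous_sinh.comp (by fun_prop)).div
      (Real.continuous_cosh.comp (by fun_prop)) fun m => (Real.cosh_pos _).ne'
  have hint : Integrable fun m => g m * Real.tanh (|m| / 2) :=
    hg.mul_bdd (c := 1) hcont.aestronglyMeasurable
      (.of_forall fun m => (Real.abs_tanh_lt_one _).le)
  have hexp : ∫ ω, Real.tanh (|M ω| / 2) ∂ℙ = ∫ m, g m * Real.tanh (|m| / 2) := by
    rw [← integral_map (f := fun m => Real.tanh (|m| / 2)) hM.aemeasurable
      hcont.aestronglyMeasurable, hlaw,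
      integral_withDensity_eq_integral_toReal_smul hg_meas.ennreal_ofReal (by simp)]
    simp [ENNReal.toReal_ofReal (hg_nonneg _)]
  have hfold : ∀ m ∈ Set.Ioi (0 : ℝ),
      g m * Real.tanh (|m| / 2) + g (-m) * Real.tanh (|-m| / 2) = g m - g (-m) := by
    intro m hm
    rw [abs_neg, abs_of_pos hm, hg_sym]
    linear_combination g m * one_add_exp_neg_mul_tanh_half m
  have hPe : ∫ m in Set.Ioi (0 : ℝ), g (-m) = ∫ m in Set.Iio (0 : ℝ), g m := by
    rw [integral_comp_neg_Ioi, neg_zero, integral_Iic_eq_integral_Iio]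
  rw [integral_eq_integral_Ioi_add_comp_neg hg,
    integral_add hg.integrableOn hg.comp_neg.integrableOn, hPe] at hg_one
  rw [hexp, integral_eq_integral_Ioi_add_comp_neg hint,
    setIntegral_congr_fun measurableSet_Ioi hfold,
    integral_sub hg.integrableOn hg.comp_neg.integrableOn, hPe]
  linear_combination hg_one
end

section
/- Let M₁ and M₂ be independent real random variables, each whose law has a symmetric LLR density, and let M_v = M₁ + M₂. Then 2·P(M_v < 0) ≥ (2·Pe(M₁))·(2·Pe(M₂)), i.e., P(M₁ + M₂ < 0) ≥ 2·P(M₁ < 0)·P(M₂ < 0). -/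
open MeasureTheory ProbabilityTheory

/-- A density with `g (-m) = exp (-m) * g m` puts at least as much mass on `(0, -x)` as on its
reflection `[x, 0)`. -/
lemma withDensity_Ico_le_Ioo_neg_of_symm {g : ℝ → ℝ} (hg_nonneg : ∀ m, 0 ≤ g m)
    (hg_sym : ∀ m : ℝ, g (-m) = Real.exp (-m) * g m) (x : ℝ) :
    volume.withDensity (fun m => ENNReal.ofReal (g m)) (Set.Ico x 0)
      ≤ volume.withDensity (fun m => ENNReal.ofReal (g m)) (Set.Ioo 0 (-x)) := by
  rw [withDensity_apply _ measurableSet_Ico, withDensity_apply _ measurableSet_Ioo,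
    setLIntegral_congr Ioo_ae_eq_Ico.symm,
    ← (Measure.measurePreserving_neg (volume : Measure ℝ)).setLIntegral_comp_preimage_emb
      (MeasurableEquiv.neg ℝ).measurableEmbedding]
  simp only [Set.neg_preimage, Set.neg_Ioo, neg_zero]
  refine setLIntegral_mono' measurableSet_Ioo fun m hm => ENNReal.ofReal_le_ofReal ?_
  rw [hg_sym]
  exact mul_le_of_le_one_left (hg_nonneg m) (Real.exp_le_one_iff.2 (by linarith [hm.1]))

lemma prod_le_of_reflect {ν₁ ν₂ : Measure ℝ} [SFinite ν₂]
    (h : ∀ x, ν₂ (Set.Ico x 0) ≤ ν₂ (Set.Ioo 0 (-x))) :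
    (ν₁.prod ν₂) {p | p.1 ≤ p.2 ∧ p.2 < 0}
      ≤ (ν₁.prod ν₂) {p | p.1 < 0 ∧ 0 < p.2 ∧ p.2 < -p.1} := by
  rw [Measure.prod_apply (by measurability), Measure.prod_apply (by measurability)]
  refine lintegral_mono fun x => ?_
  refine (h x).trans (measure_mono fun y hy => ⟨?_, hy⟩)
  linarith [hy.1, hy.2]

lemma two_mul_measure_Iio_mul_le_prod {ν₁ ν₂ : Measure ℝ} [SFinite ν₁] [SFinite ν₂]
    (h₁ : ∀ x, ν₁ (Set.Ico x 0) ≤ ν₁ (Set.Ioo 0 (-x)))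
    (h₂ : ∀ x, ν₂ (Set.Ico x 0) ≤ ν₂ (Set.Ioo 0 (-x))) :
    2 * (ν₁ (Set.Iio 0) * ν₂ (Set.Iio 0)) ≤ (ν₁.prod ν₂) {p | p.1 + p.2 < 0} := by
  set T : Set (ℝ × ℝ) := Set.Iio 0 ×ˢ Set.Iio 0
  set U₁ : Set (ℝ × ℝ) := {p | p.1 < 0 ∧ 0 < p.2 ∧ p.2 < -p.1}
  set U₂ : Set (ℝ × ℝ) := {p | p.2 < 0 ∧ 0 < p.1 ∧ p.1 < -p.2}
  have hU₁ : MeasurableSet U₁ := by measurability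
  have hU₂ : MeasurableSet U₂ := by measurability
  have hle₁ := prod_le_of_reflect (ν₁ := ν₁) h₂
  have hle₂ : (ν₁.prod ν₂) {p | p.2 ≤ p.1 ∧ p.1 < 0} ≤ (ν₁.prod ν₂) U₂ := by
    rw [← Measure.prod_swap, Measure.map_apply measurable_swap (by measurability),
      Measure.map_apply measurable_swap hU₂]
    exact prod_le_of_reflect (ν₁ := ν₂) h₁
  have hT : (ν₁.prod ν₂) T ≤ (ν₁.prod ν₂) U₁ + (ν₁.prod ν₂) U₂ := by
    refine (measure_mono fun p hp => ?_).trans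
      ((measure_union_le _ _).trans (add_le_add hle₁ hle₂))
    exact (le_total p.1 p.2).imp (fun h => ⟨h, hp.2⟩) (fun h => ⟨h, hp.1⟩)
  calc 2 * (ν₁ (Set.Iio 0) * ν₂ (Set.Iio 0))
      = (ν₁.prod ν₂) T + (ν₁.prod ν₂) T := by rw [Measure.prod_prod, two_mul]
    _ ≤ (ν₁.prod ν₂) T + ((ν₁.prod ν₂) U₁ + (ν₁.prod ν₂) U₂) := by gcongr
    _ = (ν₁.prod ν₂) (T ∪ (U₁ ∪ U₂)) := by
      rw [measure_union _ (hU₁.union hU₂), measure_union _ hU₂]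
      · exact Set.disjoint_left.2 fun p hp hq => hp.1.not_gt hq.2.1
      · refine Set.disjoint_left.2 fun p hp hq => ?_
        rcases hq with hq | hq
        · exact lt_asymm hq.2.1 hp.2
        · exact lt_asymm hq.2.1 hp.1
    _ ≤ (ν₁.prod ν₂) {p | p.1 + p.2 < 0} := by
      refine measure_mono fun p hp => ?_
      change p.1 + p.2 < 0
      rcases hp with ⟨h, h'⟩ | ⟨_, _, h⟩ | ⟨_, _, h⟩
      · exact add_neg h h'
      · linarith
      · linarith

/-- **variable-node lemma, two messages.** If `M₁` and `M₂` are
independent real random variables, each with a symmetric LLR density, then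
`2 * P(M₁ + M₂ < 0) ≥ (2 * Pe M₁) * (2 * Pe M₂)`, where
`Pe Mᵢ = ∫_{-∞}^0 gᵢ = P(Mᵢ < 0)`. -/
theorem variable_node_two_messages
    {Ω : Type*} [MeasurableSpace Ω] (μ : Measure Ω) [IsProbabilityMeasure μ]
    (M₁ M₂ : Ω → ℝ) (hM₁ : Measurable M₁) (hM₂ : Measurable M₂)
    (hindep : IndepFun M₁ M₂ μ)
    (g₁ g₂ : ℝ → ℝ)
    (hg₁_meas : Measurable g₁) (hg₂_meas : Measurable g₂)
    (hg₁_nonneg : ∀ m, 0 ≤ g₁ m) (hg₂_nonneg : ∀ m, 0 ≤ g₂ m)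
    (hg₁_one : ∫ m, g₁ m = 1) (hg₂_one : ∫ m, g₂ m = 1)
    (hg₁_sym : ∀ m : ℝ, g₁ (-m) = Real.exp (-m) * g₁ m)
    (hg₂_sym : ∀ m : ℝ, g₂ (-m) = Real.exp (-m) * g₂ m)
    (hlaw₁ : Measure.map M₁ μ = volume.withDensity (fun m => ENNReal.ofReal (g₁ m)))
    (hlaw₂ : Measure.map M₂ μ = volume.withDensity (fun m => ENNReal.ofReal (g₂ m))) :
    2 * (μ {ω | M₁ ω + M₂ ω < 0}).toReal
      ≥ (2 * ∫ m in Set.Iio (0 : ℝ), g₁ m) * (2 * ∫ m in Set.Iio (0 : ℝ), g₂ m) := by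
  have toReal_Iio : ∀ g : ℝ → ℝ, Measurable g → (∀ m, 0 ≤ g m) →
      ∫ m in Set.Iio (0 : ℝ), g m
        = (volume.withDensity (fun m => ENNReal.ofReal (g m)) (Set.Iio 0)).toReal := by
    intro g hg hg0
    rw [withDensity_apply _ measurableSet_Iio,
      integral_eq_lintegral_of_nonneg_ae (.of_forall hg0) hg.aestronglyMeasurable]
  have : IsProbabilityMeasure (μ.map M₁) := Measure.isProbabilityMeasure_map hM₁.aemeasurable
  have : IsProbabilityMeasure (μ.map M₂) := Measure.isProbabilityMeasure_map hM₂.aemeasurable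
  have key := two_mul_measure_Iio_mul_le_prod (ν₁ := μ.map M₁) (ν₂ := μ.map M₂)
    (hlaw₁ ▸ withDensity_Ico_le_Ioo_neg_of_symm hg₁_nonneg hg₁_sym)
    (hlaw₂ ▸ withDensity_Ico_le_Ioo_neg_of_symm hg₂_nonneg hg₂_sym)
  rw [← (indepFun_iff_map_prod_eq_prod_map_map hM₁.aemeasurable hM₂.aemeasurable).1 hindep,
    Measure.map_apply (hM₁.prodMk hM₂) (by measurability)] at key
  have key' := ENNReal.toReal_mono (measure_ne_top μ _) key
  rw [ENNReal.toReal_mul, ENNReal.toReal_mul, ENNReal.toReal_ofNat] at key'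
  rw [toReal_Iio g₁ hg₁_meas hg₁_nonneg, toReal_Iio g₂ hg₂_meas hg₂_nonneg, ← hlaw₁, ← hlaw₂]
  simp only [Set.preimage_ofPred_eq] at key'
  linarith
end

section
/- Let M₁ and M₂ be independent real random variables, each whose law has a symmetric LLR density. Then E[tanh(|M₁ + M₂|/2)] ≤ E[tanh(|M₁|/2)] + E[tanh(|M₂|/2)] - E[tanh(|M₁|/2)]·E[tanh(|M₂|/2)]. -/
open MeasureTheory ProbabilityTheory

lemma continuous_real_tanh : Continuous Real.tanh := by
  have h : Real.tanh = fun x => Real.sinh x / Real.cosh x :=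
    funext Real.tanh_eq_sinh_div_cosh
  rw [h]
  exact Real.continuous_sinh.div Real.continuous_cosh fun x => (Real.cosh_pos x).ne'

lemma real_tanh_abs (x : ℝ) : Real.tanh |x| = |Real.tanh x| := by
  rw [Real.tanh_eq_sinh_div_cosh, Real.tanh_eq_sinh_div_cosh, abs_div, Real.cosh_abs,
    Real.abs_sinh, abs_of_pos (Real.cosh_pos x)]

lemma real_tanh_add (x y : ℝ) :
    Real.tanh (x + y) = (Real.tanh x + Real.tanh y) / (1 + Real.tanh x * Real.tanh y) := by
  have hx := (Real.cosh_pos x).ne'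
  have hy := (Real.cosh_pos y).ne'
  have hxy := (Real.cosh_pos (x + y)).ne'
  rw [Real.cosh_add] at hxy
  have h : 1 + Real.sinh x / Real.cosh x * (Real.sinh y / Real.cosh y) =
      (Real.cosh x * Real.cosh y + Real.sinh x * Real.sinh y) / (Real.cosh x * Real.cosh y) := by
    field_simp
  simp only [Real.tanh_eq_sinh_div_cosh, h, Real.sinh_add, Real.cosh_add]
  field_simp

lemma one_add_tanh_mul_tanh_pos (x y : ℝ) : 0 < 1 + Real.tanh x * Real.tanh y := by
  have h : |Real.tanh x * Real.tanh y| < 1 := by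
    rw [abs_mul]
    nlinarith [Real.abs_tanh_lt_one x, Real.abs_tanh_lt_one y, abs_nonneg (Real.tanh x),
      abs_nonneg (Real.tanh y)]
  linarith [(abs_lt.1 h).1]

lemma tanh_abs_half_add (x y : ℝ) :
    Real.tanh (|x + y| / 2) = |Real.tanh (x / 2) + Real.tanh (y / 2)| /
      (1 + Real.tanh (x / 2) * Real.tanh (y / 2)) := by
  rw [show |x + y| / 2 = |x / 2 + y / 2| by rw [← add_div, abs_div, abs_two], real_tanh_abs,
    real_tanh_add, abs_div, abs_of_pos (one_add_tanh_mul_tanh_pos _ _)]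

lemma tanh_abs_half (x : ℝ) : Real.tanh (|x| / 2) = |Real.tanh (x / 2)| := by
  rw [← real_tanh_abs, abs_div, abs_two]

lemma abs_tanh_abs_half_le_one (x : ℝ) : |Real.tanh (|x| / 2)| ≤ 1 :=
  (Real.abs_tanh_lt_one _).le

/-- The conditional average over the two possible signs of a symmetric LLR variable. -/
noncomputable def llrSignAverage (F : ℝ → ℝ) (m : ℝ) : ℝ :=
  (1 + Real.tanh (m / 2)) / 2 * F m + (1 - Real.tanh (m / 2)) / 2 * F (-m)

lemma measurable_llrSignAverage {F : ℝ → ℝ} (hF : Measurable F) :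
    Measurable (llrSignAverage F) := by
  have := continuous_real_tanh.measurable
  unfold llrSignAverage
  fun_prop

lemma abs_llrSignAverage_le {F : ℝ → ℝ} {C : ℝ} (hC : ∀ m, |F m| ≤ C) (m : ℝ) :
    |llrSignAverage F m| ≤ C := by
  have h := abs_le.1 (hC m)
  have h' := abs_le.1 (hC (-m))
  have ht := Real.tanh_lt_one (m / 2)
  have ht' := Real.neg_one_lt_tanh (m / 2)
  unfold llrSignAverage
  rw [abs_le]
  constructor <;> nlinarith

lemma llrSignAverage_tanh_abs_half_add_le (x y : ℝ) :
    llrSignAverage (fun x => llrSignAverage (fun y => Real.tanh (|x + y| / 2)) y) x ≤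
      Real.tanh (|x| / 2) + Real.tanh (|y| / 2) - Real.tanh (|x| / 2) * Real.tanh (|y| / 2) := by
  have hs := Real.abs_tanh_lt_one (x / 2)
  have ht := Real.abs_tanh_lt_one (y / 2)
  have hp := one_add_tanh_mul_tanh_pos (x / 2) (y / 2)
  have hn := one_add_tanh_mul_tanh_pos (x / 2) (-(y / 2))
  simp only [Real.tanh_neg] at hn
  simp only [llrSignAverage, tanh_abs_half_add]
  simp only [tanh_abs_half, neg_div, Real.tanh_neg]
  generalize Real.tanh (x / 2) = s at *
  generalize Real.tanh (y / 2) = t at *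
  have h₁ : |-s + t| = |s + -t| := by rw [← abs_neg]; ring_nf
  have h₂ : |-s + -t| = |s + t| := by rw [← abs_neg]; ring_nf
  have h₃ : 1 + -s * t = 1 + s * -t := by ring
  have h₄ : 1 + -s * -t = 1 + s * t := by ring
  rw [h₁, h₂, h₃, h₄]
  have key : ∀ A B P N : ℝ, P = 1 + s * t → N = 1 + s * -t → 0 < P → 0 < N →
      (1 + s) / 2 * ((1 + t) / 2 * (A / P) + (1 - t) / 2 * (B / N)) +
      (1 - s) / 2 * ((1 + t) / 2 * (B / N) + (1 - t) / 2 * (A / P)) = (A + B) / 2 := by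
    intro A B P N hP hN hP0 hN0
    calc _ = (1 + s * t) / P * (A / 2) + (1 + s * -t) / N * (B / 2) := by ring
      _ = _ := by rw [← hP, ← hN, div_self hP0.ne', div_self hN0.ne']; ring
  rw [key _ _ _ _ rfl rfl hp hn]
  have hst : |s| * |t| ≤ |s| := mul_le_of_le_one_right (abs_nonneg s) ht.le
  have hts : |s| * |t| ≤ |t| := mul_le_of_le_one_left (abs_nonneg t) hs.le
  have hmax : |s + t| + |s + -t| ≤ 2 * max |s| |t| := by
    rcases abs_cases (s + t) with h | h <;> rcases abs_cases (s + -t) with h' | h' <;>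
    linarith [le_max_left |s| |t|, le_max_right |s| |t|, le_abs_self s, neg_le_abs s,
      le_abs_self t, neg_le_abs t]
  rcases max_cases |s| |t| with h | h <;> linarith

lemma mul_one_sub_tanh_half_even {g : ℝ → ℝ} (hg : ∀ m : ℝ, g (-m) = Real.exp (-m) * g m)
    (m : ℝ) : g (-m) * (1 - Real.tanh (-m / 2)) = g m * (1 - Real.tanh (m / 2)) := by
  have h : Real.exp (-m) = Real.exp (-(m / 2)) * Real.exp (-(m / 2)) := by
    rw [← Real.exp_add]; ring_nf
  have h' : Real.exp (m / 2) * Real.exp (-(m / 2)) = 1 := by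
    rw [← Real.exp_add]; simp
  rw [hg, neg_div, Real.tanh_neg, Real.tanh_eq, h]
  have := Real.exp_pos (m / 2)
  have := Real.exp_pos (-(m / 2))
  field_simp
  linear_combination (2 * g m * Real.exp (-(m / 2))) * h'

lemma integral_eq_integral_llrSignAverage {ν : Measure ℝ} [IsFiniteMeasure ν] {g : ℝ → ℝ}
    (hg_meas : Measurable g) (hg_nonneg : ∀ m, 0 ≤ g m)
    (hg_sym : ∀ m : ℝ, g (-m) = Real.exp (-m) * g m)
    (hν : ν = volume.withDensity (fun m => ENNReal.ofReal (g m)))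
    {F : ℝ → ℝ} (hF : Measurable F) {C : ℝ} (hC : ∀ m, |F m| ≤ C) :
    ∫ m, F m ∂ν = ∫ m, llrSignAverage F m ∂ν := by
  have htanh := continuous_real_tanh.measurable
  have hdens (G : ℝ → ℝ) : ∫ m, G m ∂ν = ∫ m, g m * G m := by
    rw [hν, integral_withDensity_eq_integral_toReal_smul hg_meas.ennreal_ofReal
      (Filter.Eventually.of_forall fun _ => ENNReal.ofReal_lt_top)]
    simp [ENNReal.toReal_ofReal, hg_nonneg]
  have hint {G : ℝ → ℝ} (hG : Measurable G) (hGC : ∀ m, |G m| ≤ C)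
      {w : ℝ → ℝ} (hw : Measurable w) (hw1 : ∀ m, |w m| ≤ 1) :
      Integrable (fun m => w m * G m) ν := by
    refine Integrable.of_bound (hw.mul hG).aestronglyMeasurable C
      (Filter.Eventually.of_forall fun m => ?_)
    rw [Real.norm_eq_abs, abs_mul]
    exact (mul_le_of_le_one_left (abs_nonneg _) (hw1 m)).trans (hGC m)
  have hw_le (m : ℝ) : |(1 - Real.tanh (m / 2)) / 2| ≤ 1 := by
    rw [abs_le]
    constructor <;> linarith [Real.tanh_lt_one (m / 2), Real.neg_one_lt_tanh (m / 2)]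
  have hw'_le (m : ℝ) : |(1 + Real.tanh (m / 2)) / 2| ≤ 1 := by
    rw [abs_le]
    constructor <;> linarith [Real.tanh_lt_one (m / 2), Real.neg_one_lt_tanh (m / 2)]
  have hw : Measurable fun m : ℝ => (1 - Real.tanh (m / 2)) / 2 := by fun_prop
  have hw' : Measurable fun m : ℝ => (1 + Real.tanh (m / 2)) / 2 := by fun_prop
  have hswap : ∫ m, (1 - Real.tanh (m / 2)) / 2 * F m ∂ν =
      ∫ m, (1 - Real.tanh (m / 2)) / 2 * F (-m) ∂ν := by
    rw [hdens, hdens, ← integral_neg_eq_self]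
    congr 1 with m
    linear_combination F (-m) / 2 * mul_one_sub_tanh_half_even hg_sym m
  have hF_neg : Measurable fun m => F (-m) := hF.comp measurable_neg
  calc ∫ m, F m ∂ν
      = ∫ m, ((1 + Real.tanh (m / 2)) / 2 * F m + (1 - Real.tanh (m / 2)) / 2 * F m) ∂ν := by
        congr 1 with m; ring
    _ = ∫ m, llrSignAverage F m ∂ν := by
        simp only [llrSignAverage]
        rw [integral_add (hint hF hC hw' hw'_le) (hint hF hC hw hw_le), hswap,
          integral_add (hint hF hC hw' hw'_le) (hint hF_neg (fun m => hC (-m)) hw hw_le)]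

lemma integral_const_add_sub_const_mul {α : Type*} [MeasurableSpace α] {ν : Measure α}
    [IsProbabilityMeasure ν] {f : α → ℝ} (hf : Integrable f ν) (a : ℝ) :
    ∫ x, (a + f x - a * f x) ∂ν = a + ∫ x, f x ∂ν - a * ∫ x, f x ∂ν := by
  have h : (fun x => a + f x - a * f x) = fun x => a + (1 - a) * f x := by
    ext x; ring
  rw [h, integral_add (integrable_const _) (hf.const_mul _), integral_const_mul]
  simp only [integral_const, probReal_univ, one_smul]
  ring

/-- If `M₁` and `M₂` are independent real random variables, each
with a symmetric LLR density, then
`E[tanh(|M₁ + M₂|/2)] ≤ E[tanh(|M₁|/2)] + E[tanh(|M₂|/2)]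
  - E[tanh(|M₁|/2)] * E[tanh(|M₂|/2)]`. -/
theorem tanh_abs_half_sum_expectation_le
    {Ω : Type*} [MeasurableSpace Ω] (μ : Measure Ω) [IsProbabilityMeasure μ]
    (M₁ M₂ : Ω → ℝ) (hM₁ : Measurable M₁) (hM₂ : Measurable M₂)
    (hindep : IndepFun M₁ M₂ μ)
    (g₁ g₂ : ℝ → ℝ)
    (hg₁_meas : Measurable g₁) (hg₂_meas : Measurable g₂)
    (hg₁_nonneg : ∀ m, 0 ≤ g₁ m) (hg₂_nonneg : ∀ m, 0 ≤ g₂ m)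
    (hg₁_one : ∫ m, g₁ m = 1) (hg₂_one : ∫ m, g₂ m = 1)
    (hg₁_sym : ∀ m : ℝ, g₁ (-m) = Real.exp (-m) * g₁ m)
    (hg₂_sym : ∀ m : ℝ, g₂ (-m) = Real.exp (-m) * g₂ m)
    (hlaw₁ : Measure.map M₁ μ = volume.withDensity (fun m => ENNReal.ofReal (g₁ m)))
    (hlaw₂ : Measure.map M₂ μ = volume.withDensity (fun m => ENNReal.ofReal (g₂ m))) :
    ∫ ω, Real.tanh (|M₁ ω + M₂ ω| / 2) ∂μ
      ≤ (∫ ω, Real.tanh (|M₁ ω| / 2) ∂μ) + (∫ ω, Real.tanh (|M₂ ω| / 2) ∂μ)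
        - (∫ ω, Real.tanh (|M₁ ω| / 2) ∂μ) * (∫ ω, Real.tanh (|M₂ ω| / 2) ∂μ) := by
  have htanh := continuous_real_tanh.measurable
  have : IsProbabilityMeasure (μ.map M₁) := Measure.isProbabilityMeasure_map hM₁.aemeasurable
  have : IsProbabilityMeasure (μ.map M₂) := Measure.isProbabilityMeasure_map hM₂.aemeasurable
  have hf : Measurable fun p : ℝ × ℝ => Real.tanh (|p.1 + p.2| / 2) := by fun_prop
  have hf₁ : Measurable fun m : ℝ => Real.tanh (|m| / 2) := by fun_prop
  have hf_right (x : ℝ) : Measurable fun y => Real.tanh (|x + y| / 2) := by fun_prop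
  have hint (ν : Measure ℝ) [IsFiniteMeasure ν] : Integrable (fun m => Real.tanh (|m| / 2)) ν :=
    Integrable.of_bound hf₁.aestronglyMeasurable 1
      (Filter.Eventually.of_forall abs_tanh_abs_half_le_one)
  have hint_right (x : ℝ) : Integrable (fun y => Real.tanh (|x + y| / 2)) (μ.map M₂) :=
    Integrable.of_bound (hf_right x).aestronglyMeasurable 1
      (Filter.Eventually.of_forall fun y => abs_tanh_abs_half_le_one (x + y))
  have hint_prod : Integrable (fun p : ℝ × ℝ => Real.tanh (|p.1 + p.2| / 2))
      ((μ.map M₁).prod (μ.map M₂)) :=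
    Integrable.of_bound hf.aestronglyMeasurable 1
      (Filter.Eventually.of_forall fun p => abs_tanh_abs_half_le_one (p.1 + p.2))
  rw [← integral_map hM₁.aemeasurable hf₁.aestronglyMeasurable,
    ← integral_map hM₂.aemeasurable hf₁.aestronglyMeasurable,
    ← integral_map (hM₁.prodMk hM₂).aemeasurable hf.aestronglyMeasurable,
    hindep.map_prod_eq_prod_map_map hM₁.aemeasurable hM₂.aemeasurable,
    integral_prod _ hint_prod]
  generalize μ.map M₁ = ν₁ at *
  generalize μ.map M₂ = ν₂ at *
  set H : ℝ → ℝ := fun x => ∫ y, Real.tanh (|x + y| / 2) ∂ν₂ with hH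
  set B : ℝ := ∫ m, Real.tanh (|m| / 2) ∂ν₂ with hB
  have hH_meas : Measurable H := hf.stronglyMeasurable.integral_prod_right'.measurable
  have hH_le (x : ℝ) : |H x| ≤ 1 := by
    have h : ‖H x‖ ≤ 1 * ν₂.real Set.univ := norm_integral_le_of_norm_le_const
      (Filter.Eventually.of_forall fun y => abs_tanh_abs_half_le_one (x + y))
    simpa using h
  have hbound (x : ℝ) : llrSignAverage H x ≤ Real.tanh (|x| / 2) + B - Real.tanh (|x| / 2) * B := by
    have hG_meas : Measurable fun y =>
        llrSignAverage (fun x => Real.tanh (|x + y| / 2)) x := by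
      unfold llrSignAverage
      fun_prop
    have hG_le (y : ℝ) : |llrSignAverage (fun x => Real.tanh (|x + y| / 2)) x| ≤ 1 :=
      abs_llrSignAverage_le (fun x => abs_tanh_abs_half_le_one (x + y)) x
    calc llrSignAverage H x
        = ∫ y, llrSignAverage (fun x => Real.tanh (|x + y| / 2)) x ∂ν₂ := by
          simp only [llrSignAverage, hH]
          rw [integral_add ((hint_right x).const_mul _) ((hint_right (-x)).const_mul _),
            integral_const_mul, integral_const_mul]
      _ = ∫ y, llrSignAverage
            (fun y => llrSignAverage (fun x => Real.tanh (|x + y| / 2)) x) y ∂ν₂ :=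
          integral_eq_integral_llrSignAverage hg₂_meas hg₂_nonneg hg₂_sym hlaw₂ hG_meas hG_le
      _ ≤ ∫ y, (Real.tanh (|x| / 2) + Real.tanh (|y| / 2)
            - Real.tanh (|x| / 2) * Real.tanh (|y| / 2)) ∂ν₂ := by
          refine integral_mono (Integrable.of_bound
            (measurable_llrSignAverage hG_meas).aestronglyMeasurable 1
            (Filter.Eventually.of_forall (abs_llrSignAverage_le hG_le)))
            (((integrable_const _).add (hint ν₂)).sub ((hint ν₂).const_mul _)) fun y => ?_
          refine le_of_eq_of_le ?_ ((llrSignAverage_tanh_abs_half_add_le y x).trans_eq (by ring))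
          simp only [add_comm]
      _ = Real.tanh (|x| / 2) + B - Real.tanh (|x| / 2) * B := by
          exact integral_const_add_sub_const_mul (hint ν₂) _
  calc ∫ x, H x ∂ν₁ = ∫ x, llrSignAverage H x ∂ν₁ :=
        integral_eq_integral_llrSignAverage hg₁_meas hg₁_nonneg hg₁_sym hlaw₁ hH_meas hH_le
    _ ≤ ∫ x, (Real.tanh (|x| / 2) + B - Real.tanh (|x| / 2) * B) ∂ν₁ :=
        integral_mono (Integrable.of_bound
          (measurable_llrSignAverage hH_meas).aestronglyMeasurable 1
          (Filter.Eventually.of_forall (abs_llrSignAverage_le hH_le)))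
          (((hint ν₁).add (integrable_const _)).sub ((hint ν₁).mul_const _)) hbound
    _ = _ := by
        simp only [add_comm _ B, mul_comm _ B]
        exact integral_const_add_sub_const_mul (hint ν₁) B
end

section
/- Let M₁ and M₂ be independent real random variables with symmetric LLR densities g₁ and g₂ respectively. Then the density of M₁ + M₂, given by the convolution g(s) = ∫_ℝ g₁(m) g₂(s - m) dm, is also a symmetric LLR density: g(-s) = e^{-s} g(s) for all s ∈ ℝ. -/
open MeasureTheory

/-- If `g₁` and `g₂` are symmetric LLR densities (measurable,
nonnegative, integrating to `1`, and satisfying `gᵢ (-m) = exp (-m) * gᵢ m`),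
then their convolution `g s = ∫ m, g₁ m * g₂ (s - m)` — the density of the sum of
two independent random variables with densities `g₁` and `g₂` — is again
symmetric: `g (-s) = exp (-s) * g s` for all `s`. -/
theorem convolution_symmetric_LLR_density
    (g₁ g₂ : ℝ → ℝ)
    (hg₁_meas : Measurable g₁) (hg₂_meas : Measurable g₂)
    (hg₁_nonneg : ∀ m, 0 ≤ g₁ m) (hg₂_nonneg : ∀ m, 0 ≤ g₂ m)
    (hg₁_one : ∫ m, g₁ m = 1) (hg₂_one : ∫ m, g₂ m = 1)
    (hg₁_sym : ∀ m : ℝ, g₁ (-m) = Real.exp (-m) * g₁ m)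
    (hg₂_sym : ∀ m : ℝ, g₂ (-m) = Real.exp (-m) * g₂ m)
    (g : ℝ → ℝ) (hg : g = fun s => ∫ m, g₁ m * g₂ (s - m)) :
    ∀ s : ℝ, g (-s) = Real.exp (-s) * g s := by
  intro s
  subst hg
  calc ∫ m, g₁ m * g₂ (-s - m)
      = ∫ m, g₁ (-m) * g₂ (-s - -m) :=
        (integral_neg_eq_self (fun m => g₁ m * g₂ (-s - m)) volume).symm
    _ = ∫ m, Real.exp (-s) * (g₁ m * g₂ (s - m)) := by
        congr 1 with m
        rw [show -s - -m = -(s - m) by ring, hg₁_sym, hg₂_sym,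
          show -s = -m + -(s - m) by ring, Real.exp_add]
        ring
    _ = Real.exp (-s) * ∫ m, g₁ m * g₂ (s - m) := integral_const_mul _ _
end
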